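/- arXiv:2205.06314 — 2 statements merged into one kernel-verified Lean document; each statement's English description precedes it below -/
import Mathlib

section
/- Suppose round r₁ is finalized at time t₁, and round r₂ is finalized at time t₂ but not finalized at time t₁. Then t₂ > t₁, r₂ > r₁, and r₁ is an ancestor of r₂. -/
/-- `Ancestor par s r` means round `s` is an ancestor of round `r`: `s` is
reached from `r` by iterating the parent function `par` one or more times,
i.e. the transitive closure of `{(s, r) : par r = some s}`. -/
def Ancestor (par : ℕ → Option ℕ) : ℕ → ℕ → Prop :=
  Relation.TransGen (fun s r => par r = some s)

/-- A round `r` is finalized at time `t` if some round `r'` is both committed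
and accepted at time `t` and `r = r'` or `r` is an ancestor of `r'`. -/
def FinalizedAt (committed accepted : ℕ → ℕ → Prop) (par : ℕ → Option ℕ)
    (t r : ℕ) : Prop :=
  ∃ r', committed t r' ∧ accepted t r' ∧ (r = r' ∨ Ancestor par r r')

open Relation

/-- An ancestor of an accepted round is an earlier accepted round. -/
theorem Ancestor.lt_and_accepted {par : ℕ → Option ℕ} {accepted : ℕ → Prop}
    (hpar : ∀ r s, accepted r → par r = some s → s < r ∧ accepted s)
    {s r : ℕ} (h : Ancestor par s r) (hr : accepted r) : s < r ∧ accepted s := by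
  induction h using TransGen.head_induction_on with
  | single h => exact hpar _ _ hr h
  | head h _ ih =>
    obtain ⟨hlt, hacc⟩ := hpar _ _ ih.2 h
    exact ⟨hlt.trans ih.1, hacc⟩

/-- Parent chains descending from a common round are comparable. -/
theorem reflTransGen_parent_total {par : ℕ → Option ℕ} {a b c : ℕ}
    (ha : ReflTransGen (fun s r => par r = some s) a c)
    (hb : ReflTransGen (fun s r => par r = some s) b c) :
    ReflTransGen (fun s r => par r = some s) a b ∨
      ReflTransGen (fun s r => par r = some s) b a := by
  have hunique : Relator.RightUnique (Function.swap fun s r => par r = some s) :=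
    fun _ _ _ h h' => Option.some.inj (h.symm.trans h')
  exact (ReflTransGen.total_of_right_unique hunique ha.swap hb.swap).symm.imp
    (fun h => h.swap) (fun h => h.swap)

/-- A round that is not skippable lies on the parent chain of every later accepted round. -/
theorem reflTransGen_parent_of_not_skippable {par : ℕ → Option ℕ} {skippable accepted : ℕ → Prop}
    (hpar : ∀ r s, accepted r → par r = some s →
      s < r ∧ accepted s ∧ ∀ u, s < u → u < r → skippable u)
    (hroot : ∀ r, accepted r → par r = none → ∀ u, u < r → skippable u)
    {c : ℕ} (hc : ¬ skippable c) {r : ℕ} (hr : accepted r) (hcr : c ≤ r) :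
    ReflTransGen (fun s r => par r = some s) c r := by
  induction r using Nat.strong_induction_on with
  | _ r ih =>
    obtain rfl | hlt := hcr.eq_or_lt
    · exact .refl
    cases hp : par r with
    | none => exact absurd (hroot r hr hp c hlt) hc
    | some s =>
      obtain ⟨hsr, hs, hskip⟩ := hpar r s hr hp
      exact (ih s hsr hs (not_lt.1 fun h => hc (hskip c h hlt))).tail hp

/-- A round is finalized iff it lies on the parent chain of a committed and accepted round. -/
theorem finalizedAt_iff {committed accepted : ℕ → ℕ → Prop} {par : ℕ → Option ℕ} {t r : ℕ} :
    FinalizedAt committed accepted par t r ↔ ∃ c, committed t c ∧ accepted t c ∧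
      ReflTransGen (fun s r => par r = some s) r c := by
  simp only [FinalizedAt, Ancestor, reflTransGen_iff_eq_or_transGen, eq_comm]

/-- **Rounds are finalized in increasing order.** Suppose round `r₁` is
finalized at time `t₁`, and round `r₂` is finalized at time `t₂` but not at
time `t₁`. Then `t₂ > t₁`, `r₂ > r₁`, and `r₁` is an ancestor of `r₂`. -/
theorem finalized_monotone
    (skippable committed accepted : ℕ → ℕ → Prop) (par : ℕ → Option ℕ)
    (hskipMono : ∀ t t' r, t ≤ t' → skippable t r → skippable t' r)
    (hcomMono : ∀ t t' r, t ≤ t' → committed t r → committed t' r)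
    (haccMono : ∀ t t' r, t ≤ t' → accepted t r → accepted t' r)
    (hpar : ∀ t r s, accepted t r → par r = some s →
      s < r ∧ accepted t s ∧ ∀ u, s < u → u < r → skippable t u)
    (hroot : ∀ t r, accepted t r → par r = none → ∀ u, u < r → skippable t u)
    (hcs : ∀ t t' r, ¬(committed t r ∧ skippable t' r))
    (r₁ r₂ t₁ t₂ : ℕ)
    (h₁ : FinalizedAt committed accepted par t₁ r₁)
    (h₂ : FinalizedAt committed accepted par t₂ r₂)
    (h₂' : ¬ FinalizedAt committed accepted par t₁ r₂) :
    t₂ > t₁ ∧ r₂ > r₁ ∧ Ancestor par r₁ r₂ := by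
  rw [finalizedAt_iff] at h₁ h₂ h₂'
  obtain ⟨c₁, hc₁, ha₁, hr₁⟩ := h₁
  obtain ⟨c₂, hc₂, ha₂, hr₂⟩ := h₂
  have ht : t₁ < t₂ := not_le.1 fun h =>
    h₂' ⟨c₂, hcomMono _ _ _ h hc₂, haccMono _ _ _ h ha₂, hr₂⟩
  have hchain : ∀ {t t' c r}, committed t c → accepted t' r → c ≤ r →
      ReflTransGen (fun s r => par r = some s) c r := fun {t t' c r} hc hr =>
    reflTransGen_parent_of_not_skippable (hpar t') (hroot t') (fun h => hcs t t' c ⟨hc, h⟩) hr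
  have hcc : c₁ ≤ c₂ := not_lt.1 fun h =>
    h₂' ⟨c₁, hc₁, ha₁, hr₂.trans (hchain hc₂ ha₁ h.le)⟩
  have hc₁r₂ : ReflTransGen (fun s r => par r = some s) c₁ r₂ :=
    (reflTransGen_parent_total (hchain hc₁ ha₂ hcc) hr₂).resolve_right
      fun h => h₂' ⟨c₁, hc₁, ha₁, h⟩
  have hanc : Ancestor par r₁ r₂ := by
    obtain rfl | h := reflTransGen_iff_eq_or_transGen.1 hc₁r₂
    · exact absurd ⟨_, hc₁, ha₁, .refl⟩ h₂'
    · exact h.trans_right hr₁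
  have hpar' : ∀ r s, accepted t₂ r → par r = some s → s < r ∧ accepted t₂ s :=
    fun r s hr hs => ⟨(hpar t₂ r s hr hs).1, (hpar t₂ r s hr hs).2.1⟩
  have hacc : accepted t₂ r₂ := by
    obtain rfl | h := reflTransGen_iff_eq_or_transGen.1 hr₂
    · exact ha₂
    · exact (Ancestor.lt_and_accepted hpar' h ha₂).2
  exact ⟨ht, (hanc.lt_and_accepted hpar' hacc).1, hanc⟩
end

section
/- Suppose round s is finalized at some time t₁, r < s, and r is not an ancestor of s. Then r is not finalized at any time t. -/
open Relation in
/-- Two weak ancestors of a common round are comparable. -/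
theorem ancestors_total {par : ℕ → Option ℕ} {r s m : ℕ}
    (hr : ReflTransGen (fun s r => par r = some s) r m)
    (hs : ReflTransGen (fun s r => par r = some s) s m) :
    ReflTransGen (fun s r => par r = some s) r s ∨
      ReflTransGen (fun s r => par r = some s) s r := by
  have hU : Relator.RightUnique (Function.swap fun s r => par r = some s) :=
    fun _ _ _ h₁ h₂ => Option.some.inj (h₁.symm.trans h₂)
  rcases ReflTransGen.total_of_right_unique hU hr.swap hs.swap with h | h
  · exact Or.inr h.swap
  · exact Or.inl h.swap

open Relation in
/-- A weak ancestor of an accepted round is accepted and does not exceed it. -/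
theorem accepted_and_le_of_reflTransGen {accepted : ℕ → Prop} {par : ℕ → Option ℕ}
    (hpar : ∀ r s, accepted r → par r = some s → s < r ∧ accepted s) {s r : ℕ}
    (h : ReflTransGen (fun s r => par r = some s) s r) (hr : accepted r) :
    accepted s ∧ s ≤ r := by
  induction h with
  | refl => exact ⟨hr, le_rfl⟩
  | tail _ hbc ih =>
    obtain ⟨hlt, hacc⟩ := hpar _ _ hr hbc
    exact ⟨(ih hacc).1, (ih hacc).2.trans hlt.le⟩

open Relation in
/-- A non-skippable round is a weak ancestor of every accepted round above it. -/
theorem reflTransGen_of_not_skippable {skippable accepted : ℕ → Prop} {par : ℕ → Option ℕ}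
    (hpar : ∀ r s, accepted r → par r = some s →
      s < r ∧ accepted s ∧ ∀ u, s < u → u < r → skippable u)
    (hroot : ∀ r, accepted r → par r = none → ∀ u, u < r → skippable u)
    {a : ℕ} (ha : ¬ skippable a) (b : ℕ) (hb : accepted b) (hab : a ≤ b) :
    ReflTransGen (fun s r => par r = some s) a b := by
  induction b using Nat.strong_induction_on with
  | _ b ih =>
    rcases hab.eq_or_lt with rfl | hlt
    · exact .refl
    cases hp : par b with
    | none => exact absurd (hroot b hb hp a hlt) ha
    | some c =>
      obtain ⟨hcb, hc, hskip⟩ := hpar b c hb hp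
      have hac : a ≤ c := not_lt.1 fun h => ha (hskip a h hlt)
      exact (ih c hcb hc hac).tail hp

/-- **Orphaned rounds are never finalized.** Suppose round `s` is finalized at
some time `t₁`, `r < s`, and `r` is not an ancestor of `s`. Then `r` is not
finalized at any time `t`. -/
theorem orphaned_never_finalized
    (skippable committed accepted : ℕ → ℕ → Prop) (par : ℕ → Option ℕ)
    (hskipMono : ∀ t t' r, t ≤ t' → skippable t r → skippable t' r)
    (hcomMono : ∀ t t' r, t ≤ t' → committed t r → committed t' r)
    (haccMono : ∀ t t' r, t ≤ t' → accepted t r → accepted t' r)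
    (hpar : ∀ t r s, accepted t r → par r = some s →
      s < r ∧ accepted t s ∧ ∀ u, s < u → u < r → skippable t u)
    (hroot : ∀ t r, accepted t r → par r = none → ∀ u, u < r → skippable t u)
    (hcs : ∀ t t' r, ¬(committed t r ∧ skippable t' r))
    (r s t₁ : ℕ)
    (hs : FinalizedAt committed accepted par t₁ s)
    (hrs : r < s) (hanc : ¬ Ancestor par r s) :
    ∀ t, ¬ FinalizedAt committed accepted par t r := by
  rintro t ⟨b, hbc, hba, hrb⟩
  obtain ⟨a, hac, haa, hsa⟩ := hs
  have weaken {x y : ℕ} (h : x = y ∨ Ancestor par x y) :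
      Relation.ReflTransGen (fun s r => par r = some s) x y :=
    h.elim (fun e => e ▸ .refl) Relation.TransGen.to_reflTransGen
  obtain ⟨m, T, hm, hrm, hsm⟩ : ∃ m T, accepted T m ∧
      Relation.ReflTransGen (fun s r => par r = some s) r m ∧
      Relation.ReflTransGen (fun s r => par r = some s) s m := by
    rcases le_total a b with hab | hba'
    · exact ⟨b, t, hba, weaken hrb, (weaken hsa).trans <|
        reflTransGen_of_not_skippable (hpar t) (hroot t)
          (fun h => hcs t₁ t a ⟨hac, h⟩) b hba hab⟩
    · exact ⟨a, t₁, haa, (weaken hrb).trans <|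
        reflTransGen_of_not_skippable (hpar t₁) (hroot t₁)
          (fun h => hcs t t₁ b ⟨hbc, h⟩) a haa hba', weaken hsa⟩
  have hpar' : ∀ r s, accepted T r → par r = some s → s < r ∧ accepted T s :=
    fun r s hr h => ⟨(hpar T r s hr h).1, (hpar T r s hr h).2.1⟩
  rcases ancestors_total hrm hsm with h | h
  · rcases Relation.reflTransGen_iff_eq_or_transGen.1 h with e | h
    · exact hrs.ne' e
    · exact hanc h
  · have hr := (accepted_and_le_of_reflTransGen hpar' hrm hm).1
    exact hrs.not_ge (accepted_and_le_of_reflTransGen hpar' h hr).2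
end
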